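/- arXiv:2303.10065 — 6 statements merged into one kernel-verified Lean document; each statement's English description precedes it below -/
import Mathlib

section
/- Let μ be a positive Borel measure on ℝ, let b > 0, and let v : ℝ → ℂ be measurable such that the function λ ↦ e^{tλ} v(λ) lies in L²(μ) for every t ∈ [0,b). Suppose there exist C > 0 and N > 0 such that ‖e^{tλ} v‖_{L²(μ)} ≤ C (b−t)^{−N} for all t ∈ [0,b). Then for every measurable f : ℝ → ℂ such that λ ↦ λⁿ f(λ) lies in L²(μ) for every n ∈ ℕ, the function λ ↦ \overline{f(λ)} e^{bλ} v(λ) is μ-integrable and lim_{t→b⁻} ∫_ℝ \overline{f(λ)} e^{tλ} v(λ) dμ(λ) = ∫_ℝ \overline{f(λ)} e^{bλ} v(λ) dμ(λ). -/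
open MeasureTheory Filter Real Set Complex

/-- Cauchy–Schwarz for the integral of a product of norms. -/
lemma integral_norm_mul_norm_le_eLpNorm {α : Type*} [MeasurableSpace α] {μ : Measure α}
    {g h : α → ℂ} (hg : MemLp g 2 μ) (hh : MemLp h 2 μ) :
    Integrable (fun x => ‖g x‖ * ‖h x‖) μ ∧
      ∫ x, ‖g x‖ * ‖h x‖ ∂μ ≤ (eLpNorm g 2 μ).toReal * (eLpNorm h 2 μ).toReal := by
  have hint : Integrable (fun x => g x * h x) μ := hg.integrable_mul hh
  have hnorm : (fun x => ‖g x‖ * ‖h x‖) = fun x => ‖g x * h x‖ := by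
    ext x; rw [norm_mul]
  rw [hnorm]
  refine ⟨hint.norm, ?_⟩
  rw [integral_norm_eq_lintegral_enorm hint.1, ← eLpNorm_one_eq_lintegral_enorm,
    ← ENNReal.toReal_mul]
  refine ENNReal.toReal_mono (ENNReal.mul_ne_top hg.2.ne hh.2.ne) ?_
  exact eLpNorm_smul_le_mul_eLpNorm (p := 2) (q := 2) (r := 1) (φ := g) (f := h) hh.1 hg.1

/-- If `l ∈ [k + 1, k + 2)`, passing from the exponent `b - b / (k + 1)` to `b` costs at most the
constant factor `exp (2 * b)`. -/
lemma exp_mul_le_of_mem_Ico {b l : ℝ} (hb : 0 < b) (k : ℕ)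
    (hl : l ∈ Set.Ico ((k : ℝ) + 1) (k + 2)) :
    Real.exp (b * l) ≤ Real.exp (2 * b) * Real.exp ((b - b / (k + 1)) * l) := by
  have hk : (0 : ℝ) < k + 1 := by positivity
  rw [← Real.exp_add]
  apply Real.exp_le_exp.mpr
  have h : b / (k + 1) * l ≤ 2 * b := by
    rw [div_mul_eq_mul_div, div_le_iff₀ hk]
    have hl2 := hl.2
    have hk0 : (0 : ℝ) ≤ k := k.cast_nonneg
    nlinarith
  linarith

lemma Ici_one_subset_iUnion_Ico :
    Set.Ici (1 : ℝ) ⊆ ⋃ k : ℕ, Set.Ico ((k : ℝ) + 1) (k + 2) := by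
  intro l hl
  have hl' : 0 ≤ l - 1 := sub_nonneg.mpr hl
  refine Set.mem_iUnion.mpr ⟨⌊l - 1⌋₊, ?_, ?_⟩
  · linarith [Nat.floor_le hl']
  · linarith [Nat.lt_floor_add_one (l - 1)]

/-- A polynomial blow-up bound as `t → b` makes `f * exp (b * l) * v` integrable for every `f`
that is square integrable against all powers of `l`. -/
lemma integrable_norm_mul_exp_mul_norm {μ : Measure ℝ} {b : ℝ} (hb : 0 < b) {v : ℝ → ℂ}
    (hv : Measurable v)
    (hL2 : ∀ t ∈ Set.Ico (0 : ℝ) b, MemLp (fun l => Real.exp (t * l) • v l) 2 μ)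
    {C N : ℝ} (hC : 0 < C)
    (hbound : ∀ t ∈ Set.Ico (0 : ℝ) b,
      eLpNorm (fun l => Real.exp (t * l) • v l) 2 μ ≤ ENNReal.ofReal (C * (b - t) ^ (-N)))
    {f : ℝ → ℂ} (hf : Measurable f) (hfn : ∀ n : ℕ, MemLp (fun l => l ^ n • f l) 2 μ) :
    Integrable (fun l => ‖f l‖ * (Real.exp (b * l) * ‖v l‖)) μ := by
  have hmeas : Measurable (fun l => ‖f l‖ * (Real.exp (b * l) * ‖v l‖)) := by fun_prop
  rw [← integrableOn_univ, ← Set.Iio_union_Ici (a := (1 : ℝ))]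
  refine IntegrableOn.union ?_ (IntegrableOn.mono_set ?_ Ici_one_subset_iUnion_Ico)
  · have hfv : Integrable (fun l => ‖f l‖ * ‖v l‖) μ := by
      have h0 := (integral_norm_mul_norm_le_eLpNorm (hfn 0) (hL2 0 ⟨le_rfl, hb⟩)).1
      simpa using h0
    refine Integrable.mono' ((hfv.const_mul (Real.exp b)).integrableOn)
      hmeas.aestronglyMeasurable ?_
    refine (ae_restrict_mem measurableSet_Iio).mono fun l hl => ?_
    have hexp : Real.exp (b * l) ≤ Real.exp b :=
      Real.exp_le_exp.mpr (mul_le_of_le_one_right hb.le (le_of_lt hl))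
    rw [Real.norm_of_nonneg (by positivity)]
    calc ‖f l‖ * (Real.exp (b * l) * ‖v l‖) ≤ ‖f l‖ * (Real.exp b * ‖v l‖) := by gcongr
      _ = Real.exp b * (‖f l‖ * ‖v l‖) := by ring
  · set M : ℕ := ⌈N⌉₊ + 2 with hM
    set A : ℝ := (eLpNorm (fun l => l ^ M • f l) 2 μ).toReal with hA
    have ht : ∀ k : ℕ, b - b / (k + 1) ∈ Set.Ico (0 : ℝ) b := fun k => by
      have hk : (1 : ℝ) ≤ k + 1 := by simp
      exact ⟨sub_nonneg.mpr (div_le_self hb.le hk), sub_lt_self b (by positivity)⟩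
    have hCS := fun k => integral_norm_mul_norm_le_eLpNorm (hfn M) (hL2 _ (ht k))
    set c : ℕ → ℝ := fun k => Real.exp (2 * b) / ((k : ℝ) + 1) ^ M with hc
    have hc0 : ∀ k, 0 ≤ c k := fun k => by positivity
    have hpt : ∀ k : ℕ, ∀ l ∈ Set.Ico ((k : ℝ) + 1) (k + 2),
        ‖f l‖ * (Real.exp (b * l) * ‖v l‖) ≤
          c k * (‖l ^ M • f l‖ * ‖Real.exp ((b - b / (k + 1)) * l) • v l‖) := by
      intro k l hl
      have hk : (0 : ℝ) < k + 1 := by positivity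
      have hl0 : 0 ≤ l := hk.le.trans hl.1
      have hpow : ((k : ℝ) + 1) ^ M ≤ l ^ M := pow_le_pow_left₀ hk.le hl.1 M
      have hexp := exp_mul_le_of_mem_Ico hb k hl
      rw [norm_smul, norm_smul, Real.norm_of_nonneg (pow_nonneg hl0 M),
        Real.norm_of_nonneg (Real.exp_pos _).le]
      set E := Real.exp ((b - b / (k + 1)) * l)
      calc ‖f l‖ * (Real.exp (b * l) * ‖v l‖)
          ≤ ‖f l‖ * (Real.exp (2 * b) * E * ‖v l‖) := by gcongr
        _ = c k * (((k : ℝ) + 1) ^ M * ‖f l‖ * (E * ‖v l‖)) := by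
            simp only [hc]; field_simp
        _ ≤ c k * (l ^ M * ‖f l‖ * (E * ‖v l‖)) := by
            have := hc0 k
            gcongr
    have hintk : ∀ k : ℕ, IntegrableOn (fun l => ‖f l‖ * (Real.exp (b * l) * ‖v l‖))
        (Set.Ico ((k : ℝ) + 1) (k + 2)) μ := fun k => by
      refine Integrable.mono' (((hCS k).1.const_mul (c k)).integrableOn)
        hmeas.aestronglyMeasurable ?_
      refine (ae_restrict_mem measurableSet_Ico).mono fun l hl => ?_
      rw [Real.norm_of_nonneg (by positivity)]
      exact hpt k l hl
    refine integrableOn_iUnion_of_summable_integral_norm hintk ?_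
    have hsum : Summable fun k : ℕ =>
        Real.exp (2 * b) * A * C * b ^ (-N) * (1 / ((k : ℝ) + 1) ^ 2) := by
      refine Summable.mul_left _ ?_
      have h2 := (summable_nat_add_iff 1).mpr
        (Real.summable_one_div_nat_pow.mpr (one_lt_two (α := ℕ)))
      simpa using h2
    refine Summable.of_nonneg_of_le (fun k => integral_nonneg fun l => norm_nonneg _)
      (fun k => ?_) hsum
    have hk : (0 : ℝ) < k + 1 := by positivity
    have hA0 : 0 ≤ A := ENNReal.toReal_nonneg
    have hb' : (eLpNorm (fun l => Real.exp ((b - b / (k + 1)) * l) • v l) 2 μ).toReal ≤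
        C * (b ^ (-N) * ((k : ℝ) + 1) ^ ⌈N⌉₊) := by
      refine (ENNReal.toReal_le_of_le_ofReal ?_ (hbound _ (ht k))).trans ?_
      · rw [sub_sub_cancel]; positivity
      · rw [sub_sub_cancel, Real.div_rpow hb.le hk.le, Real.rpow_neg hk.le, div_inv_eq_mul]
        gcongr
        rw [← Real.rpow_natCast]
        exact Real.rpow_le_rpow_of_exponent_le (by simp) (Nat.le_ceil N)
    calc ∫ l in Set.Ico ((k : ℝ) + 1) (k + 2), ‖‖f l‖ * (Real.exp (b * l) * ‖v l‖)‖ ∂μ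
        ≤ ∫ l in Set.Ico ((k : ℝ) + 1) (k + 2),
            c k * (‖l ^ M • f l‖ * ‖Real.exp ((b - b / (k + 1)) * l) • v l‖) ∂μ := by
          refine setIntegral_mono_on (hintk k).norm ((hCS k).1.const_mul (c k)).integrableOn
            measurableSet_Ico fun l hl => ?_
          rw [Real.norm_of_nonneg (by positivity)]
          exact hpt k l hl
      _ ≤ ∫ l, c k * (‖l ^ M • f l‖ * ‖Real.exp ((b - b / (k + 1)) * l) • v l‖) ∂μ := by
          refine setIntegral_le_integral ((hCS k).1.const_mul (c k)) (ae_of_all _ fun l => ?_)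
          have := hc0 k
          positivity
      _ ≤ c k * (A * (C * (b ^ (-N) * ((k : ℝ) + 1) ^ ⌈N⌉₊))) := by
          rw [integral_const_mul]
          refine mul_le_mul_of_nonneg_left ((hCS k).2.trans ?_) (hc0 k)
          exact mul_le_mul_of_nonneg_left hb' hA0
      _ = Real.exp (2 * b) * A * C * b ^ (-N) * (1 / ((k : ℝ) + 1) ^ 2) := by
          simp only [hc, hM, pow_add]
          field_simp

/-- Spectral form: if `e^{tλ}v ∈ L²(μ)` for `t ∈ [0,b)` with a polynomial blow-up bound
`‖e^{tλ}v‖ ≤ C (b-t)^{-N}`, then `e^{tλ}v` converges as `t → b⁻` to a distribution vector,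
i.e. pairings against all smooth vectors `f` converge to the pairing against `e^{bλ}v`. -/
theorem distribution_vector_limit_of_polynomial_bound
    (μ : Measure ℝ) (b : ℝ) (hb : 0 < b) (v : ℝ → ℂ) (hv : Measurable v)
    (hL2 : ∀ t ∈ Set.Ico (0:ℝ) b, MemLp (fun l => Real.exp (t * l) • v l) 2 μ)
    (C N : ℝ) (hC : 0 < C) (hN : 0 < N)
    (hbound : ∀ t ∈ Set.Ico (0:ℝ) b,
      eLpNorm (fun l => Real.exp (t * l) • v l) 2 μ ≤
        ENNReal.ofReal (C * (b - t) ^ (-N))) :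
    ∀ f : ℝ → ℂ, Measurable f →
      (∀ n : ℕ, MemLp (fun l => l ^ n • f l) 2 μ) →
      Integrable (fun l => (starRingEnd ℂ) (f l) * (Real.exp (b * l) • v l)) μ ∧
      Filter.Tendsto
        (fun t : ℝ => ∫ l, (starRingEnd ℂ) (f l) * (Real.exp (t * l) • v l) ∂μ)
        (nhdsWithin b (Set.Iio b))
        (nhds (∫ l, (starRingEnd ℂ) (f l) * (Real.exp (b * l) • v l) ∂μ)) := by
  intro f hf hfn
  have hmain := integrable_norm_mul_exp_mul_norm hb hv hL2 hC hbound hf hfn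
  have hfv : Integrable (fun l => ‖f l‖ * ‖v l‖) μ := by
    have h0 := (integral_norm_mul_norm_le_eLpNorm (hfn 0) (hL2 0 ⟨le_rfl, hb⟩)).1
    simpa using h0
  have hmeas : ∀ t : ℝ,
      Measurable (fun l => (starRingEnd ℂ) (f l) * (Real.exp (t * l) • v l)) := fun t => by
    have hconj : Measurable fun l => (starRingEnd ℂ) (f l) :=
      Complex.continuous_conj.measurable.comp hf
    have hexp : Measurable fun l : ℝ => Real.exp (t * l) := by fun_prop
    exact hconj.mul (hexp.smul hv)
  have hnorm : ∀ t l : ℝ, ‖(starRingEnd ℂ) (f l) * (Real.exp (t * l) • v l)‖ =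
      ‖f l‖ * (Real.exp (t * l) * ‖v l‖) := fun t l => by
    rw [norm_mul, norm_smul, RCLike.norm_conj, Real.norm_of_nonneg (Real.exp_pos _).le]
  refine ⟨hmain.mono' (hmeas b).aestronglyMeasurable (ae_of_all _ fun l => (hnorm b l).le), ?_⟩
  refine tendsto_integral_filter_of_dominated_convergence
    (fun l => ‖f l‖ * ‖v l‖ + ‖f l‖ * (Real.exp (b * l) * ‖v l‖))
    (Eventually.of_forall fun t => (hmeas t).aestronglyMeasurable) ?_ (hfv.add hmain)
    (ae_of_all _ fun l => ?_)
  · filter_upwards [Ioo_mem_nhdsLT hb] with t ht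
    refine ae_of_all _ fun l => ?_
    rw [hnorm]
    have hexp : Real.exp (t * l) ≤ 1 + Real.exp (b * l) := by
      rcases le_total l 0 with hl | hl
      · have h1 : Real.exp (t * l) ≤ 1 :=
          Real.exp_le_one_iff.mpr (mul_nonpos_of_nonneg_of_nonpos ht.1.le hl)
        linarith [Real.exp_pos (b * l)]
      · have h1 : Real.exp (t * l) ≤ Real.exp (b * l) :=
          Real.exp_le_exp.mpr (mul_le_mul_of_nonneg_right ht.2.le hl)
        linarith
    calc ‖f l‖ * (Real.exp (t * l) * ‖v l‖)
        ≤ ‖f l‖ * ((1 + Real.exp (b * l)) * ‖v l‖) := by gcongr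
      _ = ‖f l‖ * ‖v l‖ + ‖f l‖ * (Real.exp (b * l) * ‖v l‖) := by ring
  · have hcont : Continuous fun t : ℝ => (starRingEnd ℂ) (f l) * (Real.exp (t * l) • v l) := by
      fun_prop
    exact (hcont.tendsto b).mono_left nhdsWithin_le_nhds
end

section
/- Let μ be a tempered positive Borel measure on ℝ (i.e., there exists n ∈ ℕ with ∫ (1+λ²)^{−n} dμ(λ) < ∞), and suppose there exists t₀ > 0 with ∫_{(−∞,0)} e^{−t₀λ} dμ(λ) < ∞. Then every measurable f : ℝ → ℂ with λ ↦ λⁿ f(λ) in L²(μ) for all n ∈ ℕ is μ-integrable, for every t ∈ (0, t₀/2] the function λ ↦ e^{−tλ} f(λ) is μ-integrable, and lim_{t→0⁺} ∫_ℝ e^{−tλ} f(λ) dμ(λ) = ∫_ℝ f(λ) dμ(λ). -/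
open MeasureTheory Filter Real Set

/-- If all `λᵏ f` are in `L²(μ)`, then so are all `(1 + λ²)ⁿ λᵐ f`. -/
lemma memLp_one_add_sq_pow_smul {μ : Measure ℝ} {f : ℝ → ℂ}
    (hf : ∀ n : ℕ, MemLp (fun l => l ^ n • f l) 2 μ) (n m : ℕ) :
    MemLp (fun l => ((1 + l ^ 2) ^ n * l ^ m) • f l) 2 μ := by
  induction n generalizing m with
  | zero => simpa using hf m
  | succ k ih =>
    convert (ih m).add (ih (m + 2)) using 1
    funext l
    simp only [Pi.add_apply, ← add_smul]
    ring_nf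

/-- A smooth vector is integrable with respect to a tempered measure. -/
lemma integrable_of_tempered {μ : Measure ℝ}
    (htemp : ∃ n : ℕ, ∫⁻ l, ENNReal.ofReal (((1 + l ^ 2) ^ n)⁻¹) ∂μ < ⊤)
    {f : ℝ → ℂ} (hf : ∀ n : ℕ, MemLp (fun l => l ^ n • f l) 2 μ) :
    Integrable f μ := by
  obtain ⟨n, hn⟩ := htemp
  have hmeas : Measurable (fun l : ℝ => ((1 + l ^ 2) ^ n)⁻¹) := by fun_prop
  have hint : Integrable (fun l : ℝ => ((1 + l ^ 2) ^ n)⁻¹) μ :=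
    ⟨hmeas.aestronglyMeasurable,
      (hasFiniteIntegral_iff_ofReal (Eventually.of_forall fun l => by positivity)).2 hn⟩
  have hL2 : MemLp (fun l : ℝ => ((1 + l ^ 2) ^ n)⁻¹) 2 μ := by
    refine (memLp_two_iff_integrable_sq hmeas.aestronglyMeasurable).2
      (hint.mono' (hmeas.pow_const 2).aestronglyMeasurable (Eventually.of_forall fun l => ?_))
    have h0 : 0 ≤ ((1 + l ^ 2) ^ n)⁻¹ := by positivity
    have h1 : ((1 + l ^ 2) ^ n)⁻¹ ≤ 1 :=
      inv_le_one_of_one_le₀ (one_le_pow₀ (by nlinarith [sq_nonneg l]))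
    rw [Real.norm_of_nonneg (by positivity)]
    nlinarith
  refine (memLp_one_iff_integrable.1 ((memLp_one_add_sq_pow_smul hf n 0).smul hL2)).congr
    (Eventually.of_forall fun l => ?_)
  have h : (1 + l ^ 2) ^ n ≠ 0 := by positivity
  simp only [Pi.smul_apply', pow_zero, mul_one, smul_smul, inv_mul_cancel₀ h, one_smul]

/-- If `e^{-t₀λ}` is integrable on the negative half-line, then `e^{-t₀λ/2}`, cut off to that
half-line, is in `L²(μ)`. -/
lemma memLp_indicator_exp {μ : Measure ℝ} {t₀ : ℝ}
    (hneg : ∫⁻ l in Set.Iio (0:ℝ), ENNReal.ofReal (Real.exp (-t₀ * l)) ∂μ < ⊤) :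
    MemLp ((Set.Iio (0:ℝ)).indicator fun l => Real.exp (-(t₀ / 2) * l)) 2 μ := by
  rw [memLp_indicator_iff_restrict measurableSet_Iio]
  have hmeas (t : ℝ) : Measurable (fun l : ℝ => Real.exp (-t * l)) := by fun_prop
  refine (memLp_two_iff_integrable_sq (hmeas _).aestronglyMeasurable).2 ?_
  have hint : Integrable (fun l : ℝ => Real.exp (-t₀ * l)) (μ.restrict (Set.Iio 0)) :=
    ⟨(hmeas _).aestronglyMeasurable,
      (hasFiniteIntegral_iff_ofReal (Eventually.of_forall fun l => by positivity)).2 hneg⟩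
  refine hint.congr (Eventually.of_forall fun l => ?_)
  simp only [← Real.exp_nat_mul]
  congr 1
  push_cast
  ring

/-- If `μ` is a tempered positive Borel measure on `ℝ` with
`∫_{(-∞,0)} e^{-t₀λ} dμ(λ) < ∞` for some `t₀ > 0`, then every smooth vector `f`
(i.e. `λ ↦ λⁿ f(λ) ∈ L²(μ)` for all `n`) is `μ`-integrable, the functions `e^{-tλ}f`
are `μ`-integrable for `t ∈ (0, t₀/2]`, and `∫ e^{-tλ} f dμ → ∫ f dμ` as `t → 0⁺`. -/
theorem smooth_vector_integrable_of_tempered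
    (μ : Measure ℝ)
    (htemp : ∃ n : ℕ, ∫⁻ l, ENNReal.ofReal (((1 + l ^ 2) ^ n)⁻¹) ∂μ < ⊤)
    (t₀ : ℝ) (ht₀ : 0 < t₀)
    (hneg : ∫⁻ l in Set.Iio (0:ℝ), ENNReal.ofReal (Real.exp (-t₀ * l)) ∂μ < ⊤) :
    ∀ f : ℝ → ℂ, Measurable f →
      (∀ n : ℕ, MemLp (fun l => l ^ n • f l) 2 μ) →
      Integrable f μ ∧
      (∀ t ∈ Set.Ioc (0:ℝ) (t₀ / 2), Integrable (fun l => Real.exp (-t * l) • f l) μ) ∧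
      Filter.Tendsto (fun t : ℝ => ∫ l, Real.exp (-t * l) • f l ∂μ)
        (nhdsWithin 0 (Set.Ioi 0)) (nhds (∫ l, f l ∂μ)) := by
  intro f hfm hf
  have hfint : Integrable f μ := integrable_of_tempered htemp hf
  set w : ℝ → ℝ := (Set.Iio (0:ℝ)).indicator fun l => Real.exp (-(t₀ / 2) * l)
  have hf0 : MemLp f 2 μ := by simpa using hf 0
  have hdom : Integrable (fun l => ‖f l‖ + ‖(w • f) l‖) μ :=
    hfint.norm.add (memLp_one_iff_integrable.1 (hf0.smul (memLp_indicator_exp hneg))).norm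
  have hmeas (t : ℝ) : AEStronglyMeasurable (fun l => Real.exp (-t * l) • f l) μ :=
    (Measurable.smul (f := fun l : ℝ => Real.exp (-t * l)) (by fun_prop) hfm).aestronglyMeasurable
  have hbound : ∀ t ∈ Set.Ioc (0:ℝ) (t₀ / 2), ∀ l : ℝ,
      ‖Real.exp (-t * l) • f l‖ ≤ ‖f l‖ + ‖(w • f) l‖ := by
    rintro t ⟨ht, ht'⟩ l
    rw [norm_smul, Real.norm_of_nonneg (Real.exp_pos _).le]
    rcases lt_or_ge l 0 with hl | hl
    · have hwl : w l = Real.exp (-(t₀ / 2) * l) := Set.indicator_of_mem (Set.mem_Iio.2 hl) _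
      rw [Pi.smul_apply', norm_smul, hwl, Real.norm_of_nonneg (Real.exp_pos _).le]
      have : Real.exp (-t * l) ≤ Real.exp (-(t₀ / 2) * l) :=
        Real.exp_le_exp.2 (by nlinarith)
      exact (mul_le_mul_of_nonneg_right this (norm_nonneg _)).trans
        (le_add_of_nonneg_left (norm_nonneg _))
    · have : Real.exp (-t * l) ≤ 1 := Real.exp_le_one_iff.2 (by nlinarith)
      exact (mul_le_of_le_one_left (norm_nonneg _) this).trans
        (le_add_of_nonneg_right (norm_nonneg _))
  refine ⟨hfint, fun t ht => hdom.mono' (hmeas t) (Eventually.of_forall (hbound t ht)), ?_⟩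
  refine tendsto_integral_filter_of_dominated_convergence _ (Eventually.of_forall hmeas)
    ?_ hdom (Eventually.of_forall fun l => ?_)
  · filter_upwards [Ioc_mem_nhdsGT (half_pos ht₀)] with t ht
    exact Eventually.of_forall (hbound t ht)
  · have hcont : Continuous (fun t : ℝ => Real.exp (-t * l) • f l) := by fun_prop
    have := hcont.tendsto 0
    simp only [neg_zero, zero_mul, Real.exp_zero, one_smul] at this
    exact this.mono_left nhdsWithin_le_nhds
end

section
/- Let μ be a positive Borel measure on ℝ, r > 0, and v ∈ L²(μ) such that e^{tλ} v ∈ L²(μ) for all t ∈ [0,r). Let ε ∈ (0,r) and w ∈ L²(μ) with e^{ελ} w ∈ L²(μ). Then for every t ∈ [ε, r) the function λ ↦ \overline{w(λ)} e^{tλ} v(λ) is μ-integrable, lim_{t→r⁻} ∫_ℝ \overline{w(λ)} e^{tλ} v(λ) dμ(λ) = ∫_ℝ \overline{e^{ελ} w(λ)} e^{(r−ε)λ} v(λ) dμ(λ), and the modulus of this limit is at most ‖e^{ελ}w‖_{L²(μ)} · ‖e^{(r−ε)λ}v‖_{L²(μ)}. -/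
open MeasureTheory Filter Real Set

theorem integrable_conj_mul_of_memLp_two {α : Type*} {m : MeasurableSpace α} {μ : Measure α}
    {f g : α → ℂ} (hf : MemLp f 2 μ) (hg : MemLp g 2 μ) :
    Integrable (fun x => (starRingEnd ℂ) (f x) * g x) μ :=
  MemLp.integrable_mul (p := 2) (q := 2) hf.star hg

theorem ofReal_norm_integral_conj_mul_le {α : Type*} {m : MeasurableSpace α} {μ : Measure α}
    {f g : α → ℂ} (hf : AEStronglyMeasurable f μ) (hg : AEStronglyMeasurable g μ) :
    ENNReal.ofReal ‖∫ x, (starRingEnd ℂ) (f x) * g x ∂μ‖ ≤ eLpNorm f 2 μ * eLpNorm g 2 μ := by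
  rw [ofReal_norm]
  calc ‖∫ x, (starRingEnd ℂ) (f x) * g x ∂μ‖ₑ
      ≤ ∫⁻ x, ‖(starRingEnd ℂ) (f x) * g x‖ₑ ∂μ := enorm_integral_le_lintegral_enorm _
    _ = eLpNorm (star f • g) 1 μ := by
      rw [eLpNorm_one_eq_lintegral_enorm]; rfl
    _ ≤ eLpNorm (star f) 2 μ * eLpNorm g 2 μ := eLpNorm_smul_le_mul_eLpNorm hg hf.star
    _ = eLpNorm f 2 μ * eLpNorm g 2 μ := by rw [eLpNorm_star]

theorem conj_mul_exp_smul_eq (ε t l : ℝ) (z u : ℂ) :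
    (starRingEnd ℂ) z * (Real.exp (t * l) • u) =
      (starRingEnd ℂ) (Real.exp (ε * l) • z) * (Real.exp ((t - ε) * l) • u) := by
  have h : Real.exp (t * l) = Real.exp (ε * l) * Real.exp ((t - ε) * l) := by
    rw [← Real.exp_add]; congr 1; ring
  simp only [Complex.real_smul, map_mul, Complex.conj_ofReal, h, Complex.ofReal_mul]
  ring

theorem exp_mul_le_one_add_exp_mul {s b : ℝ} (hs : 0 ≤ s) (hsb : s ≤ b) (l : ℝ) :
    Real.exp (s * l) ≤ 1 + Real.exp (b * l) := by
  rcases le_total 0 l with hl | hl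
  · have := Real.exp_le_exp.2 (mul_le_mul_of_nonneg_right hsb hl)
    linarith
  · have := Real.exp_le_one_iff.2 (mul_nonpos_of_nonneg_of_nonpos hs hl)
    linarith [Real.exp_pos (b * l)]

/-- Spectral form of convergence of `e^{tH}v` to a hyperfunction vector as `t → r⁻`,
paired against analytic vectors `w` with `e^{ελ}w ∈ L²(μ)`. -/
theorem hyperfunction_vector_limit
    (μ : Measure ℝ) (r : ℝ) (hr : 0 < r) (v w : ℝ → ℂ)
    (hv : Measurable v) (hw : Measurable w)
    (hvL2 : ∀ t ∈ Set.Ico (0:ℝ) r, MemLp (fun l => Real.exp (t * l) • v l) 2 μ)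
    (ε : ℝ) (hε : ε ∈ Set.Ioo 0 r)
    (hwL2 : MemLp w 2 μ)
    (hwε : MemLp (fun l => Real.exp (ε * l) • w l) 2 μ) :
    (∀ t ∈ Set.Ico ε r,
      Integrable (fun l => (starRingEnd ℂ) (w l) * (Real.exp (t * l) • v l)) μ) ∧
    Filter.Tendsto
      (fun t : ℝ => ∫ l, (starRingEnd ℂ) (w l) * (Real.exp (t * l) • v l) ∂μ)
      (nhdsWithin r (Set.Iio r))
      (nhds (∫ l, (starRingEnd ℂ) (Real.exp (ε * l) • w l) *
        (Real.exp ((r - ε) * l) • v l) ∂μ)) ∧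
    ENNReal.ofReal
        ‖∫ l, (starRingEnd ℂ) (Real.exp (ε * l) • w l) *
          (Real.exp ((r - ε) * l) • v l) ∂μ‖ ≤
      eLpNorm (fun l => Real.exp (ε * l) • w l) 2 μ *
        eLpNorm (fun l => Real.exp ((r - ε) * l) • v l) 2 μ := by
  obtain ⟨hε0, hεr⟩ := hε
  have hvr := hvL2 (r - ε) ⟨by linarith, by linarith⟩
  have hv0 : MemLp v 2 μ := by simpa using hvL2 0 ⟨le_rfl, hr⟩
  have hint : ∀ t ∈ Set.Ico ε r,
      Integrable (fun l => (starRingEnd ℂ) (w l) * (Real.exp (t * l) • v l)) μ := by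
    rintro t ⟨ht1, ht2⟩
    simp_rw [conj_mul_exp_smul_eq ε t]
    exact integrable_conj_mul_of_memLp_two hwε (hvL2 (t - ε) ⟨by linarith, by linarith⟩)
  refine ⟨hint, ?_, ofReal_norm_integral_conj_mul_le hwε.1 hvr.1⟩
  have hnear : ∀ᶠ t in nhdsWithin r (Set.Iio r), t ∈ Set.Ico ε r := Ico_mem_nhdsLT hεr
  refine tendsto_integral_filter_of_dominated_convergence
    (fun l => ‖(starRingEnd ℂ) (Real.exp (ε * l) • w l) * v l‖ +
      ‖(starRingEnd ℂ) (Real.exp (ε * l) • w l) * (Real.exp ((r - ε) * l) • v l)‖) ?_ ?_ ?_ ?_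
  · filter_upwards [hnear] with t ht using (hint t ht).1
  · filter_upwards [hnear] with t ht
    refine Eventually.of_forall fun l => ?_
    rw [conj_mul_exp_smul_eq ε t, norm_mul, norm_mul, norm_mul, norm_smul, norm_smul,
      Real.norm_of_nonneg (Real.exp_pos _).le, Real.norm_of_nonneg (Real.exp_pos _).le, ← mul_add]
    refine mul_le_mul_of_nonneg_left ?_ (norm_nonneg _)
    rw [← one_add_mul]
    exact mul_le_mul_of_nonneg_right
      (exp_mul_le_one_add_exp_mul (by linarith [ht.1]) (by linarith [ht.2]) l) (norm_nonneg _)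
  · exact (integrable_conj_mul_of_memLp_two hwε hv0).norm.add
      (integrable_conj_mul_of_memLp_two hwε hvr).norm
  · refine Eventually.of_forall fun l => ?_
    rw [← conj_mul_exp_smul_eq ε r]
    have hcont : Continuous fun t : ℝ => (starRingEnd ℂ) (w l) * (Real.exp (t * l) • v l) := by
      fun_prop
    exact (hcont.tendsto r).mono_left nhdsWithin_le_nhds
end

section
/- Let μ be a symmetric positive Borel measure on ℝ (invariant under λ ↦ −λ) and η : ℝ → ℂ measurable such that e^{−t|λ|} η ∈ L²(μ) for every t > 0 and such that the KMS relation \overline{η(−λ)} = e^{−πλ} η(λ) holds for μ-almost every λ. Then for every y ∈ (0,π), the function λ ↦ e^{−yλ} η(λ) lies in L²(μ). -/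
open MeasureTheory Filter Real Set

/-- If `μ` is a symmetric positive Borel measure on `ℝ` and `η` is a hyperfunction vector
(`e^{-t|λ|}η ∈ L²(μ)` for all `t > 0`) satisfying the KMS relation
`conj (η (-λ)) = e^{-πλ} η(λ)` μ-a.e., then `e^{-yλ} η ∈ L²(μ)` for every `y ∈ (0,π)`. -/
theorem kms_hyperfunction_in_L2_on_strip
    (μ : Measure ℝ) (hsym : Measure.map (fun l : ℝ => -l) μ = μ)
    (η : ℝ → ℂ) (hη : Measurable η)
    (hhyp : ∀ t : ℝ, 0 < t → MemLp (fun l => Real.exp (-t * |l|) • η l) 2 μ)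
    (hKMS : ∀ᵐ l ∂μ, (starRingEnd ℂ) (η (-l)) = Real.exp (-Real.pi * l) • η l) :
    ∀ y ∈ Set.Ioo (0:ℝ) Real.pi,
      MemLp (fun l => Real.exp (-y * l) • η l) 2 μ := by
  intro y hy
  have hneg : MeasurePreserving (fun l : ℝ => -l) μ μ := ⟨measurable_neg, hsym⟩
  have hreflect := (hhyp (π - y) (sub_pos.2 hy.2)).comp_measurePreserving hneg
  refine ((hhyp y hy.1).norm.add hreflect.norm).mono'
    (by fun_prop : Measurable fun l => Real.exp (-y * l) • η l).aestronglyMeasurable ?_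
  filter_upwards [hKMS] with l hl
  simp only [Pi.add_apply, Function.comp_apply, abs_neg]
  rcases le_total 0 l with h | h
  · rw [abs_of_nonneg h]
    exact le_add_of_nonneg_right (norm_nonneg _)
  · have hnorm : ‖η (-l)‖ = Real.exp (-π * l) * ‖η l‖ := by
      rw [← RCLike.norm_conj, hl, norm_smul, Real.norm_of_nonneg (Real.exp_nonneg _)]
    refine le_add_of_nonneg_of_le (norm_nonneg _) (le_of_eq ?_)
    rw [abs_of_nonpos h, norm_smul, norm_smul, hnorm, Real.norm_of_nonneg (Real.exp_nonneg _),
      Real.norm_of_nonneg (Real.exp_nonneg _), ← mul_assoc, ← Real.exp_add]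
    ring_nf
end

section
/- Let μ be a positive Borel measure on ℝ and f : ℝ → ℂ measurable with λ ↦ λᵏ f(λ) in L²(μ) for every k ∈ ℕ. For n ∈ ℕ, n ≥ 1, define f_n(λ) = e^{−λ²/(4n)} f(λ). Then: (a) for every n and every s ∈ ℝ, the function λ ↦ e^{sλ} f_n(λ) lies in L²(μ); and (b) for every k ∈ ℕ, λᵏ f_n → λᵏ f in L²(μ) as n → ∞. -/
open MeasureTheory Filter Real Set

/-- Completing the square: `s l - l² / (4a) ≤ a s²` for `a > 0`. -/
lemma mul_add_neg_sq_div_le {a : ℝ} (ha : 0 < a) (s l : ℝ) :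
    s * l + -l ^ 2 / (4 * a) ≤ a * s ^ 2 := by
  have h : a * s ^ 2 - (s * l + -l ^ 2 / (4 * a)) = (2 * a * s - l) ^ 2 / (4 * a) := by
    field_simp
    ring
  have : 0 ≤ (2 * a * s - l) ^ 2 / (4 * a) := by positivity
  linarith

/-- A Gaussian factor differs from `1` by at most its exponent. -/
lemma abs_exp_neg_sq_div_sub_one_le {a : ℝ} (ha : 0 ≤ a) (l : ℝ) :
    |Real.exp (-l ^ 2 / (4 * a)) - 1| ≤ (4 * a)⁻¹ * l ^ 2 := by
  have hx : -l ^ 2 / (4 * a) = -((4 * a)⁻¹ * l ^ 2) := by ring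
  have h0 : 0 ≤ (4 * a)⁻¹ * l ^ 2 := by positivity
  rw [hx, abs_sub_comm, abs_of_nonneg (by simpa using h0)]
  linarith [Real.add_one_le_exp (-((4 * a)⁻¹ * l ^ 2))]

/-- Gaussian mollification of a smooth vector `f` (i.e. `λᵏ f ∈ L²(μ)` for all `k`):
the functions `f_n(λ) = e^{-λ²/(4n)} f(λ)` are entire vectors (`e^{sλ} f_n ∈ L²(μ)`
for all `s ∈ ℝ`) and `λᵏ f_n → λᵏ f` in `L²(μ)` for every `k`. -/
theorem gaussian_mollification_of_smooth_vector
    (μ : Measure ℝ) (f : ℝ → ℂ) (hf : Measurable f)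
    (hsm : ∀ k : ℕ, MemLp (fun l => l ^ k • f l) 2 μ) :
    (∀ n : ℕ, 1 ≤ n → ∀ s : ℝ,
      MemLp (fun l => Real.exp (s * l) • Real.exp (-l ^ 2 / (4 * (n : ℝ))) • f l) 2 μ) ∧
    ∀ k : ℕ,
      Filter.Tendsto
        (fun n : ℕ => eLpNorm
          (fun l => l ^ k • Real.exp (-l ^ 2 / (4 * (n : ℝ))) • f l - l ^ k • f l) 2 μ)
        Filter.atTop (nhds 0) := by
  refine ⟨fun n hn s => ?_, fun k => ?_⟩
  · have hn' : (0 : ℝ) < n := by exact_mod_cast hn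
    have hf2 : MemLp f 2 μ := by simpa using hsm 0
    refine hf2.of_le_mul (c := Real.exp (n * s ^ 2)) (by fun_prop) (ae_of_all _ fun l => ?_)
    rw [smul_smul, ← Real.exp_add, norm_smul, Real.norm_eq_abs, Real.abs_exp]
    gcongr
    exact mul_add_neg_sq_div_le hn' s l
  · have hbound (n : ℕ) : eLpNorm
        (fun l => l ^ k • Real.exp (-l ^ 2 / (4 * (n : ℝ))) • f l - l ^ k • f l) 2 μ ≤
        ENNReal.ofReal (4 * (n : ℝ))⁻¹ * eLpNorm (fun l => l ^ (k + 2) • f l) 2 μ := by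
      refine eLpNorm_le_mul_eLpNorm_of_ae_le_mul (ae_of_all _ fun l => ?_) 2
      have h : l ^ k • Real.exp (-l ^ 2 / (4 * (n : ℝ))) • f l - l ^ k • f l =
          (Real.exp (-l ^ 2 / (4 * (n : ℝ))) - 1) • l ^ k • f l := by
        rw [sub_smul, one_smul, smul_comm]
      rw [h, pow_add, mul_comm (l ^ k), mul_smul, norm_smul, norm_smul (l ^ 2), ← mul_assoc,
        Real.norm_eq_abs, Real.norm_eq_abs (l ^ 2), abs_of_nonneg (sq_nonneg l)]
      gcongr
      exact abs_exp_neg_sq_div_sub_one_le n.cast_nonneg l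
    have hlim : Tendsto (fun n : ℕ => (4 * (n : ℝ))⁻¹) atTop (nhds 0) :=
      (tendsto_natCast_atTop_atTop.const_mul_atTop (by norm_num)).inv_tendsto_atTop
    refine tendsto_of_tendsto_of_tendsto_of_le_of_le tendsto_const_nhds ?_
      (fun _ => zero_le) hbound
    simpa using ENNReal.Tendsto.mul_const (ENNReal.tendsto_ofReal hlim)
      (Or.inr (hsm (k + 2)).eLpNorm_ne_top)
end

section
/- Let μ be a symmetric positive Borel measure on ℝ (invariant under λ ↦ −λ) and η : ℝ → ℂ measurable with e^{−t|λ|} η ∈ L²(μ) for every t > 0. Define ξ(λ) := \overline{η(−λ)}. Suppose that both KMS relations hold μ-almost everywhere: \overline{η(−λ)} = e^{−πλ} η(λ) and \overline{ξ(−λ)} = e^{−πλ} ξ(λ). Then η(λ) = 0 for μ-almost every λ ∈ ℝ \ {0}; in particular η ∈ L²(μ). -/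
open MeasureTheory Filter Real Set

/-- If a hyperfunction vector `η` (i.e. `e^{-t|λ|}η ∈ L²(μ)` for all `t > 0`) over a
symmetric measure `μ` satisfies the KMS relation together with its conjugate
`ξ(λ) = conj (η(-λ))`, then `η` vanishes a.e. off `{0}`; in particular `η ∈ L²(μ)`. -/
theorem kms_both_implies_fixed
    (μ : Measure ℝ) (hsym : Measure.map (fun l : ℝ => -l) μ = μ)
    (η : ℝ → ℂ) (hη : Measurable η)
    (hhyp : ∀ t : ℝ, 0 < t → MemLp (fun l => Real.exp (-t * |l|) • η l) 2 μ)
    (hKMS1 : ∀ᵐ l ∂μ, (starRingEnd ℂ) (η (-l)) = Real.exp (-Real.pi * l) • η l)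
    (hKMS2 : ∀ᵐ l ∂μ, η l = Real.exp (-Real.pi * l) • (starRingEnd ℂ) (η (-l))) :
    (∀ᵐ l ∂μ, l ≠ 0 → η l = 0) ∧ MemLp η 2 μ := by
  have hzero : ∀ᵐ l ∂μ, l ≠ 0 → η l = 0 := by
    filter_upwards [hKMS1, hKMS2] with l h₁ h₂ hl
    rw [h₁, smul_smul, ← Real.exp_add] at h₂
    have hexp : Real.exp (-Real.pi * l + -Real.pi * l) ≠ 1 := by
      rw [Ne, Real.exp_eq_one_iff]
      have : Real.pi * l ≠ 0 := mul_ne_zero Real.pi_ne_zero hl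
      contrapose! this
      linarith
    have h : (1 - Real.exp (-Real.pi * l + -Real.pi * l)) • η l = 0 := by
      rw [sub_smul, one_smul, ← h₂, sub_self]
    exact (smul_eq_zero.mp h).resolve_left (sub_ne_zero.mpr hexp.symm)
  refine ⟨hzero, (memLp_congr_ae ?_).mp (hhyp 1 one_pos)⟩
  filter_upwards [hzero] with l h
  rcases eq_or_ne l 0 with rfl | hl
  · simp
  · simp [h hl]
end
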